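/- Let (W,S) be a finite Coxeter system, c a standard Coxeter element, t ∈ T a reflection, and u, v ∈ NC(W,c) such that u ≤ v, v ⊏ vt, and vt ≤ c. Then u ⊏ ut and ut ≤ vt. -/

import Mathlib

namespace NCpaper

open CoxeterSystem

variable {B : Type*} {W : Type*} [Group W] {M : CoxeterMatrix B}

/-- The absolute length: minimal length of a factorization into reflections. -/
noncomputable def absLength (cs : CoxeterSystem M W) (w : W) : ℕ :=
  sInf {k | ∃ l : List W, (∀ t ∈ l, cs.IsReflection t) ∧ l.length = k ∧ l.prod = w}

/-- The absolute order: `v ≤ w` iff `ℓ_T w = ℓ_T (v⁻¹ w) + ℓ_T v`. -/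
noncomputable def AbsLe (cs : CoxeterSystem M W) (v w : W) : Prop :=
  absLength cs w = absLength cs (v⁻¹ * w) + absLength cs v

/-- Cover relation of the absolute order. -/
noncomputable def AbsCovBy (cs : CoxeterSystem M W) (v w : W) : Prop :=
  cs.IsReflection (v⁻¹ * w) ∧ absLength cs w = absLength cs v + 1

/-- Generating relation of the Bruhat order: multiply by a reflection, length goes up. -/
def BruhatGen (cs : CoxeterSystem M W) (v w : W) : Prop :=
  cs.IsReflection (v⁻¹ * w) ∧ cs.length v < cs.length w

/-- The Bruhat order. -/
def BruhatLe (cs : CoxeterSystem M W) : W → W → Prop := Relation.ReflTransGen (BruhatGen cs)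

/-- The strict Bruhat order. -/
def BruhatLt (cs : CoxeterSystem M W) : W → W → Prop := Relation.TransGen (BruhatGen cs)

/-- The support of an element: simple reflections occurring in every (equivalently, some)
reduced word for it. -/
def supp (cs : CoxeterSystem M W) (w : W) : Set B :=
  {i | ∀ l : List B, cs.IsReduced l → cs.wordProd l = w → i ∈ l}

/-- A standard Coxeter element: the product of all the simple reflections, each once,
in some order. -/
def IsStdCoxeterElement (cs : CoxeterSystem M W) (c : W) : Prop :=
  ∃ l : List B, l.Nodup ∧ (∀ i : B, i ∈ l) ∧ cs.wordProd l = c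

/-- Generating relation for the order `⊏`: an absolute-order cover which is Bruhat-increasing. -/
noncomputable def SqGen (cs : CoxeterSystem M W) (v w : W) : Prop :=
  AbsCovBy cs v w ∧ BruhatLt cs v w

/-- The order `⊏`. -/
noncomputable def Sq (cs : CoxeterSystem M W) : W → W → Prop :=
  Relation.ReflTransGen (SqGen cs)

/-- Generating relation for the order `≪`: an absolute-order cover which is Bruhat-decreasing. -/
noncomputable def LlGen (cs : CoxeterSystem M W) (v w : W) : Prop :=
  AbsCovBy cs v w ∧ BruhatLt cs w v

/-- The order `≪`. -/
noncomputable def Ll (cs : CoxeterSystem M W) : W → W → Prop :=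
  Relation.ReflTransGen (LlGen cs)


section Absolute

theorem absLength_le_of_list (cs : CoxeterSystem M W) (l : List W)
    (hl : ∀ t ∈ l, cs.IsReflection t) : absLength cs l.prod ≤ l.length :=
  Nat.sInf_le ⟨l, hl, rfl, rfl⟩

theorem absLength_spec (cs : CoxeterSystem M W) (w : W) :
    ∃ l : List W, (∀ t ∈ l, cs.IsReflection t) ∧ l.length = absLength cs w ∧ l.prod = w := by
  have hne : {k | ∃ l : List W, (∀ t ∈ l, cs.IsReflection t) ∧ l.length = k ∧
      l.prod = w}.Nonempty := by
    obtain ⟨ω, rfl⟩ := cs.wordProd_surjective w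
    refine ⟨_, ω.map cs.simple, ?_, rfl, rfl⟩
    intro t ht
    obtain ⟨i, _, rfl⟩ := List.mem_map.mp ht
    exact cs.isReflection_simple i
  exact Nat.sInf_mem hne

theorem absLength_mul_le (cs : CoxeterSystem M W) (u v : W) :
    absLength cs (u * v) ≤ absLength cs u + absLength cs v := by
  obtain ⟨l1, h1, h2, h3⟩ := absLength_spec cs u
  obtain ⟨l2, h4, h5, h6⟩ := absLength_spec cs v
  have := absLength_le_of_list cs (l1 ++ l2)
    (fun t ht => (List.mem_append.mp ht).elim (h1 t) (h4 t))
  rwa [List.prod_append, h3, h6, List.length_append, h2, h5] at this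

theorem absLength_refl_le (cs : CoxeterSystem M W) {t : W} (ht : cs.IsReflection t) :
    absLength cs t ≤ 1 := by
  have := absLength_le_of_list cs [t] (by simpa using ht)
  simpa using this

theorem absLength_wordProd_le (cs : CoxeterSystem M W) (l : List B) :
    absLength cs (cs.wordProd l) ≤ l.length := by
  induction l with
  | nil => simpa using absLength_le_of_list cs [] (by simp)
  | cons i l ih =>
    rw [wordProd_cons]
    have h1 := absLength_mul_le cs (cs.simple i) (cs.wordProd l)
    have h2 := absLength_refl_le cs (cs.isReflection_simple i)
    simp only [List.length_cons]
    omega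

theorem absLength_conj_le (cs : CoxeterSystem M W) (g w : W) :
    absLength cs (g * w * g⁻¹) ≤ absLength cs w := by
  obtain ⟨l, h1, h2, rfl⟩ := absLength_spec cs w
  have := absLength_le_of_list cs (l.map (fun x => MulAut.conj g x)) (by
    intro t ht
    obtain ⟨x, hx, rfl⟩ := List.mem_map.mp ht
    exact (h1 x hx).conj g)
  rw [List.length_map, h2] at this
  rw [← MulAut.conj_apply, map_list_prod]
  exact this

theorem absLength_conj (cs : CoxeterSystem M W) (g w : W) :
    absLength cs (g * w * g⁻¹) = absLength cs w := by
  refine le_antisymm (absLength_conj_le cs g w) ?_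
  have := absLength_conj_le cs g⁻¹ (g * w * g⁻¹)
  have e : g⁻¹ * (g * w * g⁻¹) * g⁻¹⁻¹ = w := by group
  rwa [e] at this

theorem AbsLe.trans' {cs : CoxeterSystem M W} {u v w : W} (h1 : AbsLe cs u v)
    (h2 : AbsLe cs v w) : AbsLe cs u w := by
  unfold AbsLe at *
  have h3 := absLength_mul_le cs (u⁻¹ * v) (v⁻¹ * w)
  have h4 := absLength_mul_le cs u (u⁻¹ * w)
  rw [show u⁻¹ * v * (v⁻¹ * w) = u⁻¹ * w by group] at h3
  rw [show u * (u⁻¹ * w) = w by group] at h4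
  omega

theorem AbsLe.conj' {cs : CoxeterSystem M W} {u v : W} (h1 : AbsLe cs u v) (g : W) :
    AbsLe cs (g * u * g⁻¹) (g * v * g⁻¹) := by
  unfold AbsLe at *
  rw [show (g * u * g⁻¹)⁻¹ * (g * v * g⁻¹) = g * (u⁻¹ * v) * g⁻¹ by group]
  simp only [absLength_conj]
  exact h1

theorem AbsLe.drop' {cs : CoxeterSystem M W} {s x c : W} (hs : cs.IsReflection s)
    (hx : absLength cs (s * x) = absLength cs x + 1) (h : AbsLe cs (s * x) (s * c)) :
    AbsLe cs x c := by
  unfold AbsLe at *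
  rw [show (s * x)⁻¹ * (s * c) = x⁻¹ * c by group] at h
  have h1 := absLength_mul_le cs s c
  have h2 := absLength_refl_le cs hs
  have h3 := absLength_mul_le cs x (x⁻¹ * c)
  rw [show x * (x⁻¹ * c) = c by group] at h3
  omega

theorem absLe_mul_refl {cs : CoxeterSystem M W} {u v t : W} (ht : cs.IsReflection t)
    (huv : AbsLe cs u v) (hvt : absLength cs (v * t) = absLength cs v + 1) :
    absLength cs (u * t) = absLength cs u + 1 ∧ AbsLe cs (u * t) (v * t) := by
  unfold AbsLe at *
  have h1 := absLength_mul_le cs u t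
  have h2 := absLength_refl_le cs ht
  have h3 := absLength_mul_le cs (u * t) ((u * t)⁻¹ * (v * t))
  have h4 := absLength_conj cs t (u⁻¹ * v)
  rw [show (u * t) * ((u * t)⁻¹ * (v * t)) = v * t by group] at h3
  have h5 : (u * t)⁻¹ * (v * t) = t * (u⁻¹ * v) * t⁻¹ := by
    rw [mul_inv_rev, ht.inv]; group
  rw [h5, h4] at h3 ⊢
  omega

end Absolute

section Geometry

variable [Fintype B] [DecidableEq B]

/-- The standard bilinear form of a Coxeter matrix. -/
noncomputable def bf (M : CoxeterMatrix B) : (B → ℝ) →ₗ[ℝ] (B → ℝ) →ₗ[ℝ] ℝ :=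
  Matrix.toLinearMap₂' ℝ (Matrix.of fun i j => -Real.cos (Real.pi / (M i j : ℝ)))

/-- Simple roots. -/
noncomputable def sr (i : B) : B → ℝ := Pi.single i 1

theorem bf_sr (M : CoxeterMatrix B) (i j : B) :
    bf M (sr i) (sr j) = -Real.cos (Real.pi / (M i j : ℝ)) := by
  unfold bf sr
  rw [Matrix.toLinearMap₂'_apply']
  simp

theorem bf_sr_self (M : CoxeterMatrix B) (i : B) : bf M (sr i) (sr i) = 1 := by
  simp [bf_sr]

theorem vec_eq_sum (x : B → ℝ) : x = ∑ i, x i • (sr i : B → ℝ) := by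
  funext j
  simp [sr, Finset.sum_apply, Pi.single_apply]

theorem bf_symm (M : CoxeterMatrix B) (x y : B → ℝ) : bf M x y = bf M y x := by
  rw [vec_eq_sum x, vec_eq_sum y]
  simp only [map_sum, map_smul, LinearMap.sum_apply, LinearMap.smul_apply, bf_sr]
  simp only [Finset.smul_sum]
  rw [Finset.sum_comm]
  refine Finset.sum_congr rfl fun i _ => Finset.sum_congr rfl fun j _ => ?_
  rw [M.symmetric]
  simp only [smul_eq_mul]
  ring

/-- Reflection in the vector `a`. -/
noncomputable def rf (M : CoxeterMatrix B) (a : B → ℝ) : Module.End ℝ (B → ℝ) :=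
  LinearMap.id - ((2 : ℝ) • bf M a).smulRight a

theorem rf_apply (M : CoxeterMatrix B) (a x : B → ℝ) :
    rf M a x = x - (2 * bf M a x) • a := by
  simp [rf]

theorem rf_rf (M : CoxeterMatrix B) {a : B → ℝ} (ha : bf M a a = 1) (x : B → ℝ) :
    rf M a (rf M a x) = x := by
  rw [rf_apply, rf_apply, map_sub, map_smul, ha]
  simp only [smul_eq_mul, mul_one]
  module

theorem bf_rf (M : CoxeterMatrix B) {a : B → ℝ} (ha : bf M a a = 1) (x y : B → ℝ) :
    bf M (rf M a x) (rf M a y) = bf M x y := by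
  simp only [rf_apply, map_sub, map_smul, LinearMap.sub_apply, LinearMap.smul_apply, ha,
    smul_eq_mul, bf_symm M x a]
  ring

/-- The sequence `sin (kθ) / sin θ`. -/
noncomputable def gs (c : ℝ) : ℕ → ℝ
  | 0 => 0
  | 1 => 1
  | (k+2) => 2 * c * gs c (k+1) - gs c k

theorem gs_sin (θ : ℝ) (k : ℕ) : gs (Real.cos θ) k * Real.sin θ = Real.sin (k * θ) := by
  induction k using Nat.twoStepInduction with
  | zero => simp [gs]
  | one => simp [gs]
  | more k h1 h2 =>
    rw [gs, sub_mul, mul_assoc, h2, h1]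
    have e1 : ((k + 2 : ℕ) : ℝ) * θ = ((k+1 : ℕ) : ℝ) * θ + θ := by push_cast; ring
    have e2 : ((k : ℕ) : ℝ) * θ = ((k+1 : ℕ) : ℝ) * θ - θ := by push_cast; ring
    rw [e1, e2, Real.sin_add, Real.sin_sub]
    ring

theorem gs_one (k : ℕ) : gs 1 k = k := by
  induction k using Nat.twoStepInduction with
  | zero => simp [gs]
  | one => simp [gs]
  | more k h1 h2 =>
    rw [gs, h2, h1]; push_cast; ring

theorem sin_pos_of_two_le {m : ℕ} (hm : 2 ≤ m) : 0 < Real.sin (Real.pi / m) := by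
  have hm' : (2 : ℝ) ≤ m := by exact_mod_cast hm
  apply Real.sin_pos_of_pos_of_lt_pi
  · have := Real.pi_pos
    positivity
  · rw [div_lt_iff₀ (by linarith)]
    nlinarith [Real.pi_pos]

theorem gs_nonneg {m : ℕ} (hm1 : m ≠ 1) (k : ℕ) (hk : m ≠ 0 → k ≤ m) :
    0 ≤ gs (Real.cos (Real.pi / m)) k := by
  rcases Nat.eq_zero_or_pos m with h0 | h0
  · subst h0; simp [gs_one]
  · have hs := sin_pos_of_two_le (m := m) (by omega)
    have h := gs_sin (Real.pi / m) k
    have hkm : (k : ℝ) ≤ m := by exact_mod_cast hk (by omega)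
    have hm0 : (0 : ℝ) < m := by exact_mod_cast h0
    have : 0 ≤ Real.sin (k * (Real.pi / m)) := by
      apply Real.sin_nonneg_of_nonneg_of_le_pi
      · have := Real.pi_pos
        positivity
      · rw [mul_div_assoc', div_le_iff₀ hm0]
        nlinarith [Real.pi_pos]
    rw [← h] at this
    exact nonneg_of_mul_nonneg_left this hs

theorem rf_sr_comb (M : CoxeterMatrix B) (i j : B) (p q : ℝ) :
    rf M (sr j) (p • sr i + q • sr j) =
      p • sr i + (2 * Real.cos (Real.pi / M i j) * p - q) • sr j := by
  rw [rf_apply]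
  simp only [map_add, map_smul, bf_sr_self, smul_eq_mul, bf_symm M (sr j) (sr i), bf_sr M i j]
  module

theorem rf_pow_sr (M : CoxeterMatrix B) (i j : B) (k : ℕ) :
    ((rf M (sr i) * rf M (sr j)) ^ k) (sr i) =
      gs (Real.cos (Real.pi / M i j)) (2*k+1) • sr i +
      gs (Real.cos (Real.pi / M i j)) (2*k) • sr j := by
  induction k with
  | zero => simp [gs]
  | succ k ih =>
    rw [pow_succ', Module.End.mul_apply, ih, Module.End.mul_apply, rf_sr_comb,
      add_comm, rf_sr_comb, M.symmetric j i]
    have e1 : 2 * (k+1) + 1 = (2*k+1) + 2 := by ring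
    have e2 : 2 * (k+1) = (2*k) + 2 := by ring
    rw [e1, e2, gs, gs]
    rw [add_comm]

theorem rf_pow_sr_self (M : CoxeterMatrix B) (i j : B) (h : 2 ≤ M i j) :
    ((rf M (sr i) * rf M (sr j)) ^ (M i j)) (sr i) = sr i := by
  have hs := (sin_pos_of_two_le h)
  have hm0 : (M i j : ℝ) ≠ 0 := by
    have : M i j ≠ 0 := by omega
    exact_mod_cast this
  rw [rf_pow_sr]
  have h1 := gs_sin (Real.pi / M i j) (2 * M i j + 1)
  have h2 := gs_sin (Real.pi / M i j) (2 * M i j)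
  have e1 : ((2 * M i j + 1 : ℕ) : ℝ) * (Real.pi / M i j) = Real.pi / M i j + 2 * Real.pi := by
    push_cast; field_simp; ring
  have e2 : ((2 * M i j : ℕ) : ℝ) * (Real.pi / M i j) = 2 * Real.pi := by
    push_cast; field_simp
  rw [e1, Real.sin_add_two_pi] at h1
  rw [e2, Real.sin_two_pi] at h2
  have h1' : gs (Real.cos (Real.pi / M i j)) (2 * M i j + 1) = 1 :=
    mul_right_cancel₀ hs.ne' (by rw [h1, one_mul])
  have h2' : gs (Real.cos (Real.pi / M i j)) (2 * M i j) = 0 :=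
    (mul_eq_zero.mp h2).resolve_right hs.ne'
  rw [h1', h2']
  simp

theorem rf_liftable (M : CoxeterMatrix B) : M.IsLiftable (fun i => rf M (sr i)) := by
  intro i j
  have hself : ∀ i, rf M (sr i) * rf M (sr i) = 1 := fun i =>
    LinearMap.ext fun x => rf_rf M (bf_sr_self M i) x
  by_cases hij : i = j
  · subst hij
    rw [hself, one_pow]
  have hM1 : M i j ≠ 1 := M.off_diagonal i j hij
  rcases Nat.eq_zero_or_pos (M i j) with h0 | h0
  · rw [h0, pow_zero]
  have h2 : 2 ≤ M i j := by omega
  have hi := rf_pow_sr_self M i j h2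
  have hj : ((rf M (sr i) * rf M (sr j)) ^ (M i j)) (sr j) = sr j := by
    have h := rf_pow_sr_self M j i (by rw [M.symmetric]; exact h2)
    rw [M.symmetric j i] at h
    have hinv : (rf M (sr i) * rf M (sr j)) ^ (M i j) * (rf M (sr j) * rf M (sr i)) ^ (M i j)
        = 1 := by
      have ha : (rf M (sr i) * rf M (sr j)) * (rf M (sr j) * rf M (sr i)) = 1 := by
        rw [mul_assoc, ← mul_assoc (rf M (sr j)), hself, one_mul, hself]
      have hb : (rf M (sr j) * rf M (sr i)) * (rf M (sr i) * rf M (sr j)) = 1 := by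
        rw [mul_assoc, ← mul_assoc (rf M (sr i)), hself, one_mul, hself]
      have hc : Commute (rf M (sr i) * rf M (sr j)) (rf M (sr j) * rf M (sr i)) := by
        unfold Commute SemiconjBy; rw [ha, hb]
      rw [← hc.mul_pow, ha, one_pow]
    have h' := congrArg ((rf M (sr i) * rf M (sr j)) ^ (M i j)) h
    rw [← Module.End.mul_apply, hinv] at h'
    exact h'.symm
  have hs := (sin_pos_of_two_le h2)
  refine LinearMap.ext fun x => ?_
  set c := Real.cos (Real.pi / M i j) with hc
  set s := Real.sin (Real.pi / M i j) with hsd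
  have hsc : s ^ 2 + c ^ 2 = 1 := Real.sin_sq_add_cos_sq _
  set b1 := bf M (sr i) x
  set b2 := bf M (sr j) x
  set p := (b1 + c * b2) / s ^ 2 with hp
  set q := (b2 + c * b1) / s ^ 2 with hq
  have hp1 : p * s ^ 2 = b1 + c * b2 := by rw [hp]; field_simp
  have hq1 : q * s ^ 2 = b2 + c * b1 := by rw [hq]; field_simp
  have hs2 : s ^ 2 ≠ 0 := by positivity
  obtain ⟨y, hy⟩ : ∃ y, y = x - p • sr i - q • sr j := ⟨_, rfl⟩
  have hxy : x = y + p • sr i + q • sr j := by rw [hy]; abel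
  have hbij : bf M (sr i) (sr j) = -c := bf_sr M i j
  have hyi : bf M (sr i) y = 0 := by
    rw [hy]
    simp only [map_sub, map_smul, bf_sr_self, hbij, smul_eq_mul]
    change b1 - _ - _ = 0
    apply mul_right_cancel₀ hs2
    linear_combination (-1) * hp1 + c * hq1 + b1 * hsc
  have hyj : bf M (sr j) y = 0 := by
    rw [hy]
    simp only [map_sub, map_smul, bf_sr_self, bf_symm M (sr j) (sr i), hbij, smul_eq_mul]
    change b2 - _ - _ = 0
    apply mul_right_cancel₀ hs2
    linear_combination c * hp1 - hq1 + b2 * hsc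
  have hfix : ∀ k : ℕ, ((rf M (sr i) * rf M (sr j)) ^ k) y = y := by
    intro k
    induction k with
    | zero => rfl
    | succ k ih =>
      rw [pow_succ', Module.End.mul_apply, ih, Module.End.mul_apply, rf_apply M (sr j), hyj]
      simp only [mul_zero, zero_smul, sub_zero]
      rw [rf_apply, hyi]
      simp
  rw [hxy, map_add, map_add, map_smul, map_smul, hfix, hi, hj]
  rfl

/-- The geometric representation. -/
noncomputable def rep (cs : CoxeterSystem M W) : W →* Module.End ℝ (B → ℝ) :=
  cs.lift ⟨fun i => rf M (sr i), rf_liftable M⟩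

theorem rep_simple (cs : CoxeterSystem M W) (i : B) : rep cs (cs.simple i) = rf M (sr i) :=
  cs.lift_apply_simple _ _

theorem rep_mul_apply (cs : CoxeterSystem M W) (u v : W) (x : B → ℝ) :
    rep cs (u * v) x = rep cs u (rep cs v x) := by
  rw [map_mul]; rfl

theorem rep_one_apply (cs : CoxeterSystem M W) (x : B → ℝ) :
    rep cs 1 x = x := by
  rw [map_one]; rfl

theorem rep_inv_apply (cs : CoxeterSystem M W) (u : W) (x : B → ℝ) :
    rep cs u⁻¹ (rep cs u x) = x := by
  rw [← rep_mul_apply, inv_mul_cancel, rep_one_apply]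

theorem rep_apply_inv (cs : CoxeterSystem M W) (u : W) (x : B → ℝ) :
    rep cs u (rep cs u⁻¹ x) = x := by
  rw [← rep_mul_apply, mul_inv_cancel, rep_one_apply]

theorem bf_rep (cs : CoxeterSystem M W) (w : W) (x y : B → ℝ) :
    bf M (rep cs w x) (rep cs w y) = bf M x y := by
  induction w using cs.simple_induction_left generalizing x y with
  | one => simp [rep_one_apply]
  | mul_simple_left w i ih =>
    rw [rep_mul_apply, rep_mul_apply, rep_simple, bf_rf M (bf_sr_self M i), ih]

/-- Letter to be prepended at step `k`. -/
def nxt (i j : B) (k : ℕ) : B := if Even k then j else i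

theorem wordProd_alt_succ (cs : CoxeterSystem M W) (i j : B) (k : ℕ) :
    cs.wordProd (alternatingWord i j (k+1)) =
      cs.simple (nxt i j k) * cs.wordProd (alternatingWord i j k) := by
  rw [alternatingWord_succ', wordProd_cons]; rfl

theorem rep_alt (cs : CoxeterSystem M W) (i j : B) (k : ℕ) :
    rep cs (cs.wordProd (alternatingWord i j k)) (sr i) =
      gs (Real.cos (Real.pi / M i j)) (k+1) • sr (nxt i j (k+1)) +
      gs (Real.cos (Real.pi / M i j)) k • sr (nxt i j k) := by
  induction k with
  | zero => simp [gs, nxt, alternatingWord, rep_one_apply]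
  | succ k ih =>
    rw [wordProd_alt_succ, rep_mul_apply, ih, rep_simple, rf_sr_comb, add_comm]
    have hM : M (nxt i j (k+1)) (nxt i j k) = M i j := by
      unfold nxt
      by_cases hk : Even k
      · have : ¬ Even (k+1) := by simpa [Nat.even_add_one] using hk
        simp [hk, this]
      · have : Even (k+1) := by simpa [Nat.even_add_one] using hk
        simp [hk, this, M.symmetric j i]
    have hn : nxt i j (k+1+1) = nxt i j k := by
      simp [nxt, Nat.even_add_one]
    rw [hM, hn]
    rfl

theorem rep_sr_nonneg (cs : CoxeterSystem M W) (n : ℕ) : ∀ (w : W) (i : B), cs.length w = n →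
    cs.length w < cs.length (w * cs.simple i) → 0 ≤ rep cs w (sr i) := by
  induction n using Nat.strong_induction_on with
  | _ n IH =>
  intro w i hn hi
  have hsr : ∀ i : B, (0 : B → ℝ) ≤ sr i := fun i => Pi.single_nonneg.mpr zero_le_one
  by_cases hw : w = 1
  · subst hw; rw [rep_one_apply]; exact hsr i
  obtain ⟨j, hj⟩ := cs.exists_rightDescent_of_ne_one hw
  have hij : i ≠ j := by
    rintro rfl
    unfold IsRightDescent at hj; omega
  have key : ∀ N : ℕ, ∀ (v : W) (k : ℕ), cs.length v = N → 1 ≤ k →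
      w = v * cs.wordProd (alternatingWord i j k) → cs.length w = cs.length v + k →
      0 ≤ rep cs w (sr i) := by
    intro N
    induction N using Nat.strong_induction_on with
    | _ N IHN =>
    intro v k hv hk hwv hl
    by_cases hd : cs.IsRightDescent v (nxt i j k)
    · rw [isRightDescent_iff] at hd
      refine IHN (cs.length (v * cs.simple (nxt i j k))) (by omega) _ (k+1) rfl (by omega) ?_
        (by omega)
      rw [wordProd_alt_succ, ← mul_assoc, simple_mul_simple_cancel_right, hwv]
    · have h1 : 0 ≤ rep cs v (sr (nxt i j k)) := by
        refine IH (cs.length v) (by omega) v _ rfl ?_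
        rw [not_isRightDescent_iff] at hd; omega
      have h2 : 0 ≤ rep cs v (sr (nxt i j (k+1))) := by
        refine IH (cs.length v) (by omega) v _ rfl ?_
        obtain ⟨k', rfl⟩ : ∃ k', k = k' + 1 := ⟨k - 1, by omega⟩
        have hn : nxt i j (k'+1+1) = nxt i j k' := by
          simp [nxt, Nat.even_add_one]
        rw [hn]
        rw [wordProd_alt_succ, ← mul_assoc] at hwv
        have := cs.length_mul_le (v * cs.simple (nxt i j k')) (cs.wordProd (alternatingWord i j k'))
        rw [← hwv] at this
        have h3 := cs.length_wordProd_le (alternatingWord i j k')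
        rw [length_alternatingWord] at h3
        omega
      have hkm : M i j ≠ 0 → k + 1 ≤ M i j := by
        intro hM
        by_contra hcon
        have hnr := cs.not_isReduced_alternatingWord j i (m := k+1)
          (by rw [M.symmetric]; exact hM) (by rw [M.symmetric]; omega)
        apply hnr
        unfold CoxeterSystem.IsReduced
        have h4 : w * cs.simple i = v * cs.wordProd (alternatingWord j i (k+1)) := by
          rw [alternatingWord_succ, wordProd_concat, hwv, mul_assoc]
        have h5 := cs.length_mul_le v (cs.wordProd (alternatingWord j i (k+1)))
        rw [← h4] at h5
        have h6 := cs.length_wordProd_le (alternatingWord j i (k+1))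
        rw [length_alternatingWord] at h6 ⊢
        omega
      have hM1 : M i j ≠ 1 := M.off_diagonal i j hij
      rw [hwv, rep_mul_apply, rep_alt, map_add, map_smul, map_smul]
      exact add_nonneg (smul_nonneg (gs_nonneg hM1 _ hkm) h2)
        (smul_nonneg (gs_nonneg hM1 _ fun h => by have := hkm h; omega) h1)
  rw [isRightDescent_iff] at hj
  refine key _ (w * cs.simple j) 1 rfl le_rfl ?_ (by omega)
  simp [alternatingWord]


theorem sr_nonneg (i : B) : (0 : B → ℝ) ≤ sr i := Pi.single_nonneg.mpr zero_le_one

theorem sr_same (i : B) : (sr i : B → ℝ) i = 1 := by simp [sr]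

theorem sr_ne {i j : B} (h : j ≠ i) : (sr i : B → ℝ) j = 0 := by simp [sr, h]

theorem rf_self (M : CoxeterMatrix B) {a : B → ℝ} (ha : bf M a a = 1) : rf M a a = -a := by
  rw [rf_apply, ha]; module

/-- Roots. -/
def IsRt (cs : CoxeterSystem M W) (a : B → ℝ) : Prop := ∃ w i, a = rep cs w (sr i)

theorem isRt_sr (cs : CoxeterSystem M W) (i : B) : IsRt cs (sr i) :=
  ⟨1, i, (rep_one_apply cs _).symm⟩

theorem IsRt.bf_self {cs : CoxeterSystem M W} {a : B → ℝ} (h : IsRt cs a) : bf M a a = 1 := by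
  obtain ⟨w, i, rfl⟩ := h
  rw [bf_rep, bf_sr_self]

theorem IsRt.ne_zero {cs : CoxeterSystem M W} {a : B → ℝ} (h : IsRt cs a) : a ≠ 0 := by
  rintro rfl
  have := h.bf_self
  simp at this

theorem IsRt.rep {cs : CoxeterSystem M W} {a : B → ℝ} (h : IsRt cs a) (w : W) :
    IsRt cs (rep cs w a) := by
  obtain ⟨v, i, rfl⟩ := h
  exact ⟨w * v, i, by rw [rep_mul_apply]⟩

theorem rep_mul_simple_sr (cs : CoxeterSystem M W) (w : W) (i : B) :
    rep cs (w * cs.simple i) (sr i) = - rep cs w (sr i) := by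
  rw [rep_mul_apply, rep_simple, rf_self M (bf_sr_self M i), map_neg]

theorem IsRt.neg {cs : CoxeterSystem M W} {a : B → ℝ} (h : IsRt cs a) : IsRt cs (-a) := by
  obtain ⟨v, i, rfl⟩ := h
  exact ⟨v * cs.simple i, i, by rw [rep_mul_simple_sr]⟩

theorem rep_sr_nonpos (cs : CoxeterSystem M W) (w : W) (i : B)
    (h : cs.length (w * cs.simple i) < cs.length w) : rep cs w (sr i) ≤ 0 := by
  have := rep_sr_nonneg cs _ (w * cs.simple i) i rfl
    (by rw [simple_mul_simple_cancel_right]; exact h)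
  rw [rep_mul_simple_sr] at this
  exact neg_nonneg.mp this

theorem IsRt.nonneg_or_nonpos {cs : CoxeterSystem M W} {a : B → ℝ} (h : IsRt cs a) :
    0 ≤ a ∨ a ≤ 0 := by
  obtain ⟨w, i, rfl⟩ := h
  rcases lt_or_ge (cs.length w) (cs.length (w * cs.simple i)) with h1 | h1
  · exact Or.inl (rep_sr_nonneg cs _ w i rfl h1)
  · exact Or.inr (rep_sr_nonpos cs w i (lt_of_le_of_ne h1 (cs.length_mul_simple_ne w i)))

theorem IsRt.nonneg_of_coord {cs : CoxeterSystem M W} {a : B → ℝ} (h : IsRt cs a) {i : B}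
    (hi : 0 < a i) : 0 ≤ a := by
  rcases h.nonneg_or_nonpos with h1 | h1
  · exact h1
  · exact absurd (h1 i) (not_le.mpr hi)

theorem IsRt.eq_sr {cs : CoxeterSystem M W} {a : B → ℝ} (h : IsRt cs a) (h0 : 0 ≤ a) {i : B}
    (hi : ¬ 0 ≤ rf M (sr i) a) : a = sr i := by
  have hb : IsRt cs (rf M (sr i) a) := by
    rw [← rep_simple cs]; exact h.rep _
  have hb' := hb.nonneg_or_nonpos.resolve_left hi
  have hz : ∀ j, j ≠ i → a j = 0 := by
    intro j hj
    have h1 := hb' j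
    rw [rf_apply] at h1
    simp only [Pi.sub_apply, Pi.smul_apply, sr_ne hj, smul_zero, sub_zero] at h1
    exact le_antisymm h1 (h0 j)
  have ha : a = a i • sr i := by
    funext j
    by_cases hj : j = i
    · subst hj; simp [sr_same]
    · simp [hz j hj, sr_ne hj]
  have h1 := h.bf_self
  rw [ha] at h1
  simp only [map_smul, LinearMap.smul_apply, bf_sr_self, smul_eq_mul, mul_one] at h1
  have h2 : a i = 1 := by
    have h3 : (0 : ℝ) ≤ a i := h0 i
    nlinarith
  rw [ha, h2, one_smul]

theorem rep_faithful (cs : CoxeterSystem M W) {w : W} (h : ∀ x, rep cs w x = x) : w = 1 := by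
  by_contra hw
  obtain ⟨i, hi⟩ := cs.exists_rightDescent_of_ne_one hw
  have h1 := rep_sr_nonpos cs w i hi i
  rw [h, sr_same] at h1
  simp only [Pi.zero_apply] at h1
  linarith

theorem rep_inj (cs : CoxeterSystem M W) {v w : W} (h : rep cs v = rep cs w) : v = w := by
  have : v * w⁻¹ = 1 := rep_faithful cs fun x => by
    rw [rep_mul_apply, h, rep_apply_inv]
  exact mul_inv_eq_one.mp this

/-- `a` is a root of the reflection `t`. -/
def HasRt (cs : CoxeterSystem M W) (t : W) (a : B → ℝ) : Prop :=
  IsRt cs a ∧ rep cs t = rf M a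

theorem HasRt.conj {cs : CoxeterSystem M W} {t : W} {a : B → ℝ} (h : HasRt cs t a) (w : W) :
    HasRt cs (w * t * w⁻¹) (rep cs w a) := by
  refine ⟨h.1.rep w, LinearMap.ext fun x => ?_⟩
  rw [rep_mul_apply, rep_mul_apply, h.2, rf_apply, rf_apply, map_sub, map_smul, rep_apply_inv]
  have : bf M (rep cs w a) x = bf M a (rep cs w⁻¹ x) := by
    rw [← bf_rep cs w a, rep_apply_inv]
  rw [this]

theorem hasRt_simple (cs : CoxeterSystem M W) (i : B) : HasRt cs (cs.simple i) (sr i) :=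
  ⟨isRt_sr cs i, rep_simple cs i⟩

theorem HasRt.neg {cs : CoxeterSystem M W} {t : W} {a : B → ℝ} (h : HasRt cs t a) :
    HasRt cs t (-a) := by
  refine ⟨h.1.neg, LinearMap.ext fun x => ?_⟩
  rw [h.2, rf_apply, rf_apply]
  simp

theorem HasRt.unique {cs : CoxeterSystem M W} {t t' : W} {a : B → ℝ} (h : HasRt cs t a)
    (h' : HasRt cs t' a) : t = t' := rep_inj cs (h.2.trans h'.2.symm)

theorem exists_hasRt {cs : CoxeterSystem M W} {t : W} (ht : cs.IsReflection t) :
    ∃ a, HasRt cs t a ∧ 0 ≤ a := by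
  obtain ⟨w, i, rfl⟩ := ht
  have h := (hasRt_simple cs i).conj w
  rcases h.1.nonneg_or_nonpos with h1 | h1
  · exact ⟨_, h, h1⟩
  · exact ⟨_, h.neg, neg_nonneg.mpr h1⟩

theorem nonneg_of_length_lt {cs : CoxeterSystem M W} {t : W} {a : B → ℝ} (h : HasRt cs t a)
    (h0 : 0 ≤ a) (n : ℕ) : ∀ u : W, cs.length u = n → cs.length u < cs.length (u * t) →
    0 ≤ rep cs u a := by
  induction n with
  | zero =>
    intro u hu _
    rw [length_eq_zero_iff] at hu
    rw [hu, rep_one_apply]; exact h0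
  | succ n ih =>
    intro u hu hlt
    have hu1 : u ≠ 1 := by rintro rfl; simp at hu
    obtain ⟨i, hi⟩ := cs.exists_leftDescent_of_ne_one hu1
    rw [isLeftDescent_iff] at hi
    have h1 := cs.length_simple_mul (u * t) i
    have h2 := ih (cs.simple i * u) (by omega) (by rw [mul_assoc]; omega)
    by_contra hcon
    have hroot := h.conj u
    have hneg : 0 ≤ - rep cs u a := neg_nonneg.mpr (hroot.1.nonneg_or_nonpos.resolve_left hcon)
    have hsn : ¬ 0 ≤ rf M (sr i) (- rep cs u a) := by
      intro h3
      rw [rep_mul_apply, rep_simple] at h2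
      rw [map_neg, neg_nonneg] at h3
      have h4 : rep cs (cs.simple i) (rep cs u a) = 0 := by
        rw [rep_simple]; exact le_antisymm h3 h2
      exact (hroot.1.rep (cs.simple i)).ne_zero h4
    have he := hroot.neg.1.eq_sr hneg hsn
    have hneg' := hroot.neg
    rw [he] at hneg'
    have h5 := hneg'.unique (hasRt_simple cs i)
    have h6 : u * t = cs.simple i * u := by rw [← h5]; group
    rw [h6] at hlt
    omega

theorem length_lt_of_nonneg {cs : CoxeterSystem M W} {t : W} (ht : cs.IsReflection t)
    {a : B → ℝ} (h : HasRt cs t a) (h0 : 0 ≤ a) (u : W) (hu : 0 ≤ rep cs u a) :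
    cs.length u < cs.length (u * t) := by
  by_contra hcon
  have hne := ht.length_mul_left_ne u
  have h1 := nonneg_of_length_lt h h0 _ (u * t) rfl
    (by rw [mul_assoc, ht.mul_self, mul_one]; omega)
  rw [rep_mul_apply, h.2, rf_self M h.1.bf_self, map_neg, neg_nonneg] at h1
  exact (h.1.rep u).ne_zero (le_antisymm h1 hu)

/-! Finite groups: nondegeneracy. -/

theorem bf_nondeg [Finite W] (cs : CoxeterSystem M W) {x : B → ℝ}
    (hx : ∀ k, bf M (sr k) x = 0) : x = 0 := by
  have := Fintype.ofFinite W
  have hfix : ∀ w, rep cs w x = x := by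
    intro w
    induction w using cs.simple_induction_left with
    | one => exact rep_one_apply cs x
    | mul_simple_left w i ih =>
      rw [rep_mul_apply, ih, rep_simple, rf_apply, hx]; simp
  have hP : ∀ k, ∑ w : W, rep cs w (sr k) = 0 := by
    intro k
    have h1 : ∑ w : W, rep cs (w * cs.simple k) (sr k) = ∑ w : W, rep cs w (sr k) :=
      Fintype.sum_equiv (Equiv.mulRight (cs.simple k)) _ _ (fun w => rfl)
    simp only [rep_mul_simple_sr, Finset.sum_neg_distrib] at h1
    exact self_eq_neg.mp h1.symm
  have h2 : ∑ w : W, rep cs w x = 0 := by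
    have h3 : ∀ w, rep cs w x = ∑ k, x k • rep cs w (sr k) := by
      intro w
      conv_lhs => rw [vec_eq_sum x]
      rw [map_sum]
      simp only [map_smul]
    simp only [h3]
    rw [Finset.sum_comm]
    refine Finset.sum_eq_zero fun k _ => ?_
    rw [← Finset.smul_sum, hP, smul_zero]
  simp only [hfix, Finset.sum_const, Finset.card_univ] at h2
  rw [← Nat.cast_smul_eq_nsmul ℝ] at h2
  exact (smul_eq_zero.mp h2).resolve_left (by exact_mod_cast Fintype.card_ne_zero)

theorem exists_fund [Finite W] (cs : CoxeterSystem M W) (j : B) :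
    ∃ x : B → ℝ, bf M (sr j) x = 1 ∧ ∀ k, k ≠ j → bf M (sr k) x = 0 := by
  let F : (B → ℝ) →ₗ[ℝ] (B → ℝ) := LinearMap.pi fun k => bf M (sr k)
  have hinj : Function.Injective F := by
    rw [injective_iff_map_eq_zero]
    intro x hx
    exact bf_nondeg cs fun k => congrFun hx k
  obtain ⟨x, hx⟩ := (LinearMap.injective_iff_surjective.mp hinj) (sr j)
  refine ⟨x, ?_, fun k hk => ?_⟩
  · have := congrFun hx j
    rw [sr_same] at this; exact this
  · have := congrFun hx k
    rw [sr_ne hk] at this; exact this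

theorem rep_word_fix (cs : CoxeterSystem M W) {x : B → ℝ} (l : List B)
    (h : ∀ k ∈ l, bf M (sr k) x = 0) : rep cs (cs.wordProd l) x = x := by
  induction l with
  | nil => rw [wordProd_nil, rep_one_apply]
  | cons i l ih =>
    rw [wordProd_cons, rep_mul_apply, ih fun k hk => h k (List.mem_cons_of_mem _ hk),
      rep_simple, rf_apply, h i List.mem_cons_self]
    simp

theorem sr_mem_of_moved [Finite W] (cs : CoxeterSystem M W) (U : Submodule ℝ (B → ℝ))
    (l : List B) (hl : l.Nodup) (h : ∀ x, rep cs (cs.wordProd l) x - x ∈ U) :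
    ∀ j ∈ l, sr j ∈ U := by
  induction l with
  | nil => simp
  | cons i l ih =>
    rw [List.nodup_cons] at hl
    have hi : sr i ∈ U := by
      obtain ⟨x, hx1, hx2⟩ := exists_fund cs i
      have h1 := h x
      rw [wordProd_cons, rep_mul_apply, rep_word_fix cs l
        (fun k hk => hx2 k (fun e => hl.1 (e ▸ hk))), rep_simple, rf_apply, hx1] at h1
      have h2 : sr i = (-(1/2 : ℝ)) • (x - (2 * 1 : ℝ) • sr i - x) := by module
      rw [h2]; exact U.smul_mem _ h1
    intro j hj
    rcases List.mem_cons.mp hj with rfl | hj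
    · exact hi
    · refine ih hl.2 (fun x => ?_) j hj
      have h1 := h x
      rw [wordProd_cons, rep_mul_apply, rep_simple, rf_apply] at h1
      have := U.add_mem h1 (U.smul_mem (2 * bf M (sr i) (rep cs (cs.wordProd l) x)) hi)
      convert this using 1
      abel

theorem rep_cox_fix [Finite W] (cs : CoxeterSystem M W) (l : List B) (hl : l.Nodup)
    (hall : ∀ i, i ∈ l) {x : B → ℝ} (hx : rep cs (cs.wordProd l) x = x) : x = 0 := by
  let F : Module.End ℝ (B → ℝ) := rep cs (cs.wordProd l) - 1
  have hsurj : Function.Surjective F := by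
    rw [← LinearMap.range_eq_top, eq_top_iff]
    intro y _
    rw [vec_eq_sum y]
    refine Submodule.sum_mem _ fun i _ => Submodule.smul_mem _ _ ?_
    exact sr_mem_of_moved cs (LinearMap.range F) l hl (fun x => ⟨x, rfl⟩) i (hall i)
  have hinj := LinearMap.injective_iff_surjective.mpr hsurj
  apply hinj
  rw [map_zero]
  change rep cs (cs.wordProd l) x - x = 0
  rw [hx, sub_self]


theorem rep_list_moved (cs : CoxeterSystem M W) (ra : W → (B → ℝ))
    (hra : ∀ t, cs.IsReflection t → HasRt cs t (ra t)) (U : Submodule ℝ (B → ℝ)) (L : List W)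
    (hL : ∀ t ∈ L, cs.IsReflection t) (hU : ∀ t ∈ L, ra t ∈ U) (x : B → ℝ) :
    rep cs L.prod x - x ∈ U := by
  induction L with
  | nil => simp
  | cons t L ih =>
    have h1 := ih (fun t ht => hL t (List.mem_cons_of_mem _ ht))
      (fun t ht => hU t (List.mem_cons_of_mem _ ht))
    have ht := hra t (hL t List.mem_cons_self)
    rw [List.prod_cons, rep_mul_apply, ht.2, rf_apply]
    have := U.sub_mem h1
      (U.smul_mem (2 * bf M (ra t) (rep cs L.prod x)) (hU t List.mem_cons_self))
    convert this using 1
    abel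

theorem coord_preserved [Finite W] (cs : CoxeterSystem M W) (i : B) (l : List B)
    (hl : (i :: l).Nodup) {u : W} (hu : AbsLe cs u (cs.wordProd l)) (x : B → ℝ) :
    rep cs u x i = x i := by
  classical
  rw [List.nodup_cons] at hl
  have hex : ∀ t : W, ∃ a : B → ℝ, cs.IsReflection t → HasRt cs t a := by
    intro t
    by_cases ht : cs.IsReflection t
    · obtain ⟨a, ha, _⟩ := exists_hasRt ht
      exact ⟨a, fun _ => ha⟩
    · exact ⟨0, fun h => absurd h ht⟩
  choose ra hra using hex
  obtain ⟨L1, h1, h2, h3⟩ := absLength_spec cs u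
  obtain ⟨L2, h4, h5, h6⟩ := absLength_spec cs (u⁻¹ * cs.wordProd l)
  have hprod : (L1 ++ L2).prod = cs.wordProd l := by
    rw [List.prod_append, h3, h6]; group
  have hlen : (L1 ++ L2).length ≤ l.length := by
    have := absLength_wordProd_le cs l
    unfold AbsLe at hu
    rw [List.length_append]; omega
  let R : Finset (B → ℝ) := ((L1 ++ L2).map ra).toFinset
  let U : Submodule ℝ (B → ℝ) := Submodule.span ℝ (R : Set (B → ℝ))
  have hmem : ∀ t ∈ L1 ++ L2, ra t ∈ U := fun t ht =>
    Submodule.subset_span (by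
      simp only [R, List.coe_toFinset, Set.mem_setOf_eq]
      exact List.mem_map_of_mem ht)
  have hrefl : ∀ t ∈ L1 ++ L2, cs.IsReflection t :=
    fun t ht => (List.mem_append.mp ht).elim (h1 t) (h4 t)
  have hmoved : ∀ x, rep cs (cs.wordProd l) x - x ∈ U := by
    intro x
    rw [← hprod]
    exact rep_list_moved cs ra hra U _ hrefl hmem x
  have hsr := sr_mem_of_moved cs U l hl.2 hmoved
  let X : Submodule ℝ (B → ℝ) := Submodule.span ℝ (Set.range fun j : l.toFinset => sr j.1)
  have hXU : X ≤ U := by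
    rw [Submodule.span_le]
    rintro _ ⟨j, rfl⟩
    exact hsr j.1 (List.mem_toFinset.mp j.2)
  have hXdim : Module.finrank ℝ X = l.length := by
    have hli : LinearIndependent ℝ (fun j : l.toFinset => (sr j.1 : B → ℝ)) := by
      have h := (Pi.basisFun ℝ B).linearIndependent.comp
        (fun j : l.toFinset => j.1) Subtype.val_injective
      convert h using 1
      funext j
      simp [sr]
    rw [finrank_span_eq_card hli, Fintype.card_coe, List.toFinset_card_of_nodup hl.2]
  have hUdim : Module.finrank ℝ U ≤ l.length := by
    refine (finrank_span_finset_le_card R).trans ?_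
    refine (List.toFinset_card_le _).trans ?_
    rw [List.length_map]; exact hlen
  have hEq : X = U := Submodule.eq_of_le_of_finrank_le hXU (by rw [hXdim]; exact hUdim)
  have hXi : ∀ y ∈ X, y i = 0 := by
    intro y hy
    have : X ≤ LinearMap.ker (LinearMap.proj (R := ℝ) (φ := fun _ : B => ℝ) i) := by
      rw [Submodule.span_le]
      rintro _ ⟨j, rfl⟩
      have hne : i ≠ j.1 := fun e => hl.1 (e ▸ List.mem_toFinset.mp j.2)
      simp [sr_ne hne]
    exact this hy
  have hfin := rep_list_moved cs ra hra U L1 h1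
    (fun t ht => hmem t (List.mem_append_left _ ht)) x
  rw [h3, ← hEq] at hfin
  have := hXi _ hfin
  simp only [Pi.sub_apply] at this
  linarith

/-- Rotation step. -/
noncomputable def rot (M : CoxeterMatrix B) : List B × (B → ℝ) → List B × (B → ℝ)
  | ([], a) => ([], a)
  | (i :: l, a) => (l ++ [i], rf M (sr i) a)

theorem rot_iter (cs : CoxeterSystem M W) (l : List B) : ∀ (l' : List B) (a : B → ℝ),
    (rot M)^[l.length] (l ++ l', a) = (l' ++ l, rep cs (cs.wordProd l)⁻¹ a) := by
  induction l with
  | nil => intro l' a; simp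
  | cons i l ih =>
    intro l' a
    rw [List.length_cons, Function.iterate_succ_apply]
    change (rot M)^[l.length] (l ++ l' ++ [i], rf M (sr i) a) = _
    rw [List.append_assoc, ih, wordProd_cons, mul_inv_rev, rep_mul_apply, inv_simple, rep_simple]
    simp

theorem rot_iter_mul (cs : CoxeterSystem M W) (l : List B) (a : B → ℝ) (k : ℕ) :
    (rot M)^[l.length * k] (l, a) = (l, rep cs ((cs.wordProd l)⁻¹ ^ k) a) := by
  induction k with
  | zero => simp
  | succ k ih =>
    rw [Nat.mul_succ, Nat.add_comm, Function.iterate_add_apply, ih, pow_succ', rep_mul_apply]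
    have := rot_iter cs l [] (rep cs ((cs.wordProd l)⁻¹ ^ k) a)
    simpa using this

theorem exists_rot_neg [Finite W] (cs : CoxeterSystem M W) (l : List B) (hl : l.Nodup)
    (hall : ∀ i, i ∈ l) {a : B → ℝ} (ha : IsRt cs a) :
    ∃ k, ¬ 0 ≤ ((rot M)^[k] (l, a)).2 := by
  by_contra hcon
  push Not at hcon
  set d := (cs.wordProd l)⁻¹ with hd
  have hpos : ∀ k : ℕ, 0 ≤ rep cs (d ^ k) a := by
    intro k
    have := hcon (l.length * k)
    rwa [rot_iter_mul cs] at this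
  have hN : 0 < orderOf d := orderOf_pos d
  have hfix : rep cs d (∑ k ∈ Finset.range (orderOf d), rep cs (d ^ k) a) =
      ∑ k ∈ Finset.range (orderOf d), rep cs (d ^ k) a := by
    rw [map_sum]
    have h1 : ∀ k, rep cs d (rep cs (d ^ k) a) = rep cs (d ^ (k+1)) a := by
      intro k; rw [← rep_mul_apply, pow_succ']
    simp only [h1]
    have h2 := Finset.sum_range_succ (fun k => rep cs (d ^ k) a) (orderOf d)
    rw [Finset.sum_range_succ' (fun k => rep cs (d ^ k) a), pow_orderOf_eq_one, pow_zero] at h2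
    exact add_right_cancel h2
  have hz : ∑ k ∈ Finset.range (orderOf d), rep cs (d ^ k) a = 0 := by
    apply rep_cox_fix cs l hl hall
    conv_lhs => rw [← hfix]
    rw [hd, rep_apply_inv]
  rw [Finset.sum_eq_zero_iff_of_nonneg (fun k _ => hpos k)] at hz
  have := hz 0 (Finset.mem_range.mpr hN)
  rw [pow_zero, rep_one_apply] at this
  exact ha.ne_zero this

theorem main_ind [Finite W] (cs : CoxeterSystem M W) (k : ℕ) :
    ∀ (l : List B) (a : B → ℝ) (t u v : W), l.Nodup → (∀ i, i ∈ l) → cs.IsReflection t →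
    HasRt cs t a → 0 ≤ a → 0 ≤ rep cs v a → AbsLe cs u v →
    absLength cs (v * t) = absLength cs v + 1 → AbsLe cs (v * t) (cs.wordProd l) →
    ¬ 0 ≤ ((rot M)^[k] (l, a)).2 → 0 ≤ rep cs u a := by
  induction k with
  | zero => intro l a t u v _ _ _ _ h0 _ _ _ _ hn; exact absurd h0 hn
  | succ k ih =>
    intro l a t u v hl hall ht hta h0 hva huv hvt hle hn
    rcases l with _ | ⟨i, l⟩
    · obtain ⟨w, j, _⟩ := hta.1
      exact absurd (hall j) (by simp)
    have hs := cs.isReflection_simple i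
    rw [wordProd_cons] at hle
    obtain ⟨hut, hutvt⟩ := absLe_mul_refl ht huv hvt
    have hsi := hasRt_simple cs i
    by_cases h1 : 0 ≤ rf M (sr i) a
    · by_cases h2 : 0 ≤ rf M (sr i) (rep cs v a)
      · -- generic case
        by_contra hcon
        have e : ∀ g : W, rep cs (cs.simple i * g * (cs.simple i)⁻¹) (rf M (sr i) a) =
            rf M (sr i) (rep cs g a) := by
          intro g
          rw [← rep_simple cs, rep_mul_apply, rep_inv_apply, rep_mul_apply]
        have hrt' := hta.conj (cs.simple i)
        rw [rep_simple] at hrt'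
        have hl' : (l ++ [i]).Nodup := by
          rw [List.nodup_append_comm]; exact hl
        have hall' : ∀ j, j ∈ l ++ [i] := by
          intro j
          have := hall j
          simp only [List.mem_cons] at this
          simp only [List.mem_append, List.mem_singleton]
          tauto
        have em : cs.simple i * v * (cs.simple i)⁻¹ * (cs.simple i * t * (cs.simple i)⁻¹) =
            cs.simple i * (v * t) * (cs.simple i)⁻¹ := by group
        have ec : cs.wordProd (l ++ [i]) =
            cs.simple i * (cs.simple i * cs.wordProd l) * (cs.simple i)⁻¹ := by
          rw [simple_mul_simple_cancel_left, wordProd_append, wordProd_singleton, inv_simple]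
        have h3 := ih (l ++ [i]) (rf M (sr i) a) _ (cs.simple i * u * (cs.simple i)⁻¹)
          (cs.simple i * v * (cs.simple i)⁻¹) hl' hall' (ht.conj (cs.simple i)) hrt' h1
          (by rw [e]; exact h2) (huv.conj' _)
          (by rw [em, absLength_conj, absLength_conj]; exact hvt)
          (by rw [em, ec]; exact hle.conj' _) hn
        rw [e] at h3
        have hroot := hta.conj u
        have hneg : 0 ≤ - rep cs u a :=
          neg_nonneg.mpr (hroot.1.nonneg_or_nonpos.resolve_left hcon)
        have hsn : ¬ 0 ≤ rf M (sr i) (- rep cs u a) := by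
          intro h4
          rw [map_neg, neg_nonneg] at h4
          have h5 : rep cs (cs.simple i) (rep cs u a) = 0 := by
            rw [rep_simple]; exact le_antisymm h4 h3
          exact (hroot.1.rep (cs.simple i)).ne_zero h5
        have he := hroot.neg.1.eq_sr hneg hsn
        have hneg' := hroot.neg
        rw [he] at hneg'
        have h5 := hneg'.unique hsi
        have h6 : u * t = cs.simple i * u := by rw [← h5]; group
        have huc : AbsLe cs (u * t) (cs.simple i * cs.wordProd l) := hutvt.trans' hle
        rw [h6] at huc hut
        have h7 := coord_preserved cs i l hl (huc.drop' hs hut) a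
        have h8 := congrFun he i
        rw [sr_same, Pi.neg_apply, h7] at h8
        have h9 : (0 : ℝ) ≤ a i := h0 i
        linarith
      · -- `v a = sr i`
        have hroot := hta.conj v
        have he := hroot.1.eq_sr hva h2
        rw [he] at hroot
        have h5 := hroot.unique hsi
        have h6 : v * t = cs.simple i * v := by rw [← h5]; group
        rw [h6] at hle hvt
        have hvl := hle.drop' hs hvt
        have h7 := coord_preserved cs i l hl hvl a
        have h8 := coord_preserved cs i l hl (huv.trans' hvl) a
        refine (hta.1.rep u).nonneg_of_coord (i := i) ?_
        rw [h8, ← h7, he, sr_same]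
        exact one_pos
    · -- `a = sr i`
      have he := hta.1.eq_sr h0 h1
      subst he
      have hts : t = cs.simple i := hta.unique hsi
      subst hts
      obtain ⟨x, hx⟩ : ∃ x, x = cs.simple i * v * cs.simple i := ⟨_, rfl⟩
      have hvx : v * cs.simple i = cs.simple i * x := by
        rw [hx, ← mul_assoc, simple_mul_simple_cancel_left]
      have habs : absLength cs x = absLength cs v := by
        have := absLength_conj cs (cs.simple i) v
        rwa [inv_simple, ← hx] at this
      rw [hvx] at hle hvt
      have hxl := hle.drop' hs (by rw [hvt, habs])
      have h7 := coord_preserved cs i l hl hxl (sr i)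
      rw [sr_same] at h7
      have hxr := hsi.conj x
      have hxpos : 0 ≤ rep cs x (sr i) := hxr.1.nonneg_of_coord (i := i) (by rw [h7]; exact one_pos)
      have hve : v = cs.simple i * x * cs.simple i := by
        rw [← hvx, simple_mul_simple_cancel_right]
      have hva' := hva
      rw [hve, rep_mul_simple_sr, rep_mul_apply, rep_simple, neg_nonneg] at hva'
      have h8 : rep cs x (sr i) = sr i := by
        refine hxr.1.eq_sr hxpos fun h9 => ?_
        have h10 := hxr.1.rep (cs.simple i)
        rw [rep_simple] at h10
        exact h10.ne_zero (le_antisymm hva' h9)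
      rw [h8] at hxr
      have h9 := hxr.unique hsi
      have hvx' : v = x := by
        rw [hve]
        nth_rewrite 1 [← h9]
        rw [inv_mul_cancel_right, simple_mul_simple_cancel_right]
      rw [← hvx'] at hxl
      have h11 := coord_preserved cs i l hl (huv.trans' hxl) (sr i)
      refine (hta.1.rep u).nonneg_of_coord (i := i) ?_
      rw [h11, sr_same]
      exact one_pos

end Geometry

theorem absLength_le_of_sq {cs : CoxeterSystem M W} {v w : W} (h : Sq cs v w) :
    v = w ∨ SqGen cs v w ∨ absLength cs v + 2 ≤ absLength cs w := by
  induction h with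
  | refl => exact Or.inl rfl
  | tail _ hbc ih =>
    right
    rcases ih with rfl | h | h
    · exact Or.inl hbc
    · right
      have h1 := h.1.2
      have h2 := hbc.1.2
      omega
    · right
      have h2 := hbc.1.2
      omega

theorem length_lt_of_bruhatLt {cs : CoxeterSystem M W} {v w : W} (h : BruhatLt cs v w) :
    cs.length v < cs.length w := by
  induction h with
  | single h => exact h.2
  | tail _ h ih => exact ih.trans h.2

/-- Lemma 4.4 (simplification property): if `u ≤ v ⊏ vt ≤ c` with `t` a reflection,
then `u ⊏ ut ≤ vt`. -/
theorem stmt14 [Finite W] (cs : CoxeterSystem M W) (c : W)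
    (hc : IsStdCoxeterElement cs c) (t u v : W) (ht : cs.IsReflection t)
    (hu : AbsLe cs u c) (hv : AbsLe cs v c)
    (huv : AbsLe cs u v) (hsq : Sq cs v (v * t)) (hvt : AbsLe cs (v * t) c) :
    Sq cs u (u * t) ∧ AbsLe cs (u * t) (v * t) := by
  classical
  obtain ⟨l, hl, hall, rfl⟩ := hc
  letI : Fintype B := ⟨l.toFinset, fun i => List.mem_toFinset.mpr (hall i)⟩
  have hgen : SqGen cs v (v * t) := by
    rcases absLength_le_of_sq hsq with h | h | h
    · exact absurd (congrArg cs.length h).symm (ht.length_mul_left_ne v)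
    · exact h
    · have h1 := absLength_mul_le cs v t
      have h2 := absLength_refl_le cs ht
      omega
  have hvt1 := hgen.1.2
  obtain ⟨hut, hutvt⟩ := absLe_mul_refl ht huv hvt1
  refine ⟨?_, hutvt⟩
  obtain ⟨a, hta, h0⟩ := exists_hasRt ht
  obtain ⟨k, hk⟩ := exists_rot_neg cs l hl hall hta.1
  have hva := nonneg_of_length_lt hta h0 _ v rfl (length_lt_of_bruhatLt hgen.2)
  have hua := main_ind cs k l a t u v hl hall ht hta h0 hva huv hvt1 hvt hk
  have hlt := length_lt_of_nonneg ht hta h0 u hua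
  have hrefl : cs.IsReflection (u⁻¹ * (u * t)) := by rwa [inv_mul_cancel_left]
  exact Relation.ReflTransGen.single
    ⟨⟨hrefl, hut⟩, Relation.TransGen.single ⟨hrefl, hlt⟩⟩

end NCpaper
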